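/- arXiv:1808.03260 — 3 statements merged into one kernel-verified Lean document; each statement's English description precedes it below -/
import Mathlib

section
/- Let E be a finite set and let f : Finset E → ℤ be a monotone and submodular function. Let K ⊆ E be a nonempty subset with f(K) = f(E), and let C ⊆ E be any subset. Then there exists an element e ∈ K such that f(C ∪ {e}) − f(C) ≥ (f(E) − f(C)) / |K|; equivalently, |K| · (f(C ∪ {e}) − f(C)) ≥ f(E) − f(C). -/
/-- A function `f` on subsets of a finite set is submodular if for all
`B ⊆ A` and every `e ∉ A`, `f (B + e) - f B ≥ f (A + e) - f A`. -/
def Submodular {E : Type*} [DecidableEq E] (f : Finset E → ℤ) : Prop :=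
  ∀ ⦃B A : Finset E⦄, B ⊆ A → ∀ e ∉ A,
    f (insert e A) - f A ≤ f (insert e B) - f B

/-- The gain from adding a set `S` to `C` is at most the sum of the gains from adding the
elements of `S` separately. -/
theorem Submodular.union_sub_le_sum {E : Type*} [DecidableEq E] {f : Finset E → ℤ}
    (hsub : Submodular f) (C S : Finset E) :
    f (C ∪ S) - f C ≤ ∑ e ∈ S, (f (insert e C) - f C) := by
  induction S using Finset.induction_on with
  | empty => simp
  | insert a S ha ih =>
    rw [Finset.sum_insert ha, Finset.union_insert]
    by_cases haC : a ∈ C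
    · rw [Finset.insert_eq_of_mem (Finset.mem_union_left S haC), Finset.insert_eq_of_mem haC]
      linarith
    · have := hsub (Finset.subset_union_left : C ⊆ C ∪ S) a (by simp [haC, ha])
      linarith

/-- If `f` is monotone and submodular, `K` is nonempty with `f K = f E`, and
`C` is any subset, then some `e ∈ K` has marginal gain at least
`(f E - f C) / |K|`. -/
theorem exists_good_element {E : Type*} [Fintype E] [DecidableEq E]
    (f : Finset E → ℤ) (hmono : Monotone f) (hsub : Submodular f)
    (K : Finset E) (hK : K.Nonempty) (hKopt : f K = f Finset.univ)
    (C : Finset E) :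
    ∃ e ∈ K, (K.card : ℤ) * (f (insert e C) - f C) ≥ f Finset.univ - f C := by
  obtain ⟨e, he, hmax⟩ := K.exists_max_image (fun e => f (insert e C) - f C) hK
  refine ⟨e, he, ?_⟩
  have hsum := K.sum_le_card_nsmul _ _ hmax
  rw [nsmul_eq_mul] at hsum
  have hunion := hsub.union_sub_le_sum C K
  have hle : f K ≤ f (C ∪ K) := hmono Finset.subset_union_right
  linarith
end

section
/- Let E be a finite set and let f : Finset E → ℤ be a monotone and submodular function. Let K ⊆ E satisfy f(K) = f(E) and |K| = k ≥ 1. Let C₀ = ∅ and, for each i, let C_{i+1} = C_i ∪ {e_i} where e_i ∈ E maximizes the marginal gain f(C_i ∪ {e}) − f(C_i) over all e ∈ E. Then for every i ≥ 0, the deficiency satisfies (f(E) − f(C_i) : ℝ) ≤ (1 − 1/k)^i · (f(E) − f(∅)). -/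
/-- If every marginal gain over `A` is at most `g`, then adding a set `S` to `A` gains at most
`S.card * g`. -/
theorem Submodular.union_sub_le_card_mul {E : Type*} [DecidableEq E] {f : Finset E → ℤ}
    (hsub : Submodular f) (A S : Finset E) {g : ℤ} (hg : 0 ≤ g)
    (hgain : ∀ x, f (insert x A) - f A ≤ g) :
    f (A ∪ S) - f A ≤ S.card * g := by
  induction S using Finset.induction_on with
  | empty => simp
  | insert x S hx ih =>
    rw [Finset.card_insert_of_notMem hx, Finset.union_insert]
    push_cast
    by_cases hmem : x ∈ A ∪ S
    · rw [Finset.insert_eq_of_mem hmem]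
      linarith
    · linarith [hsub (Finset.subset_union_left (s₁ := A) (s₂ := S)) x hmem, hgain x]

/-- For the greedy sequence `C 0 = ∅`, `C (i+1) = C i + e i` where `e i`
maximizes the marginal gain over `C i`, the deficiency satisfies
`f E - f (C i) ≤ (1 - 1/k)^i * (f E - f ∅)`, where `K` is a set with
`f K = f E` and `|K| = k ≥ 1`. -/
theorem greedy_deficiency_bound {E : Type*} [Fintype E] [DecidableEq E]
    (f : Finset E → ℤ) (hmono : Monotone f) (hsub : Submodular f)
    (K : Finset E) (k : ℕ) (hk : 1 ≤ k) (hKcard : K.card = k)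
    (hKopt : f K = f Finset.univ)
    (C : ℕ → Finset E) (e : ℕ → E)
    (hC0 : C 0 = ∅)
    (hCsucc : ∀ i, C (i + 1) = insert (e i) (C i))
    (hgreedy : ∀ i, ∀ x : E,
      f (insert x (C i)) - f (C i) ≤ f (insert (e i) (C i)) - f (C i)) :
    ∀ i : ℕ, ((f Finset.univ - f (C i) : ℤ) : ℝ) ≤
      (1 - 1 / (k : ℝ)) ^ i * ((f Finset.univ - f ∅ : ℤ) : ℝ) := by
  intro i
  induction i with
  | zero => simp [hC0]
  | succ i ih =>
    have hstep : f Finset.univ - f (C i) ≤ k * (f (C (i + 1)) - f (C i)) := by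
      have hgain : 0 ≤ f (C (i + 1)) - f (C i) := by
        rw [hCsucc]
        exact sub_nonneg.2 (hmono (Finset.subset_insert _ _))
      have hunion := hsub.union_sub_le_card_mul (C i) K hgain (fun x => by
        rw [hCsucc]
        exact hgreedy i x)
      have hK : f K ≤ f (C i ∪ K) := hmono Finset.subset_union_right
      rw [hKcard] at hunion
      linarith
    have hk' : (1 : ℝ) ≤ k := by exact_mod_cast hk
    have hkpos : (0 : ℝ) < k := by linarith
    have hratio : (0 : ℝ) ≤ 1 - 1 / (k : ℝ) := by
      rw [sub_nonneg, div_le_one hkpos]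
      exact hk'
    have hstep' : ((f Finset.univ - f (C i) : ℤ) : ℝ) / k ≤
        ((f (C (i + 1)) - f (C i) : ℤ) : ℝ) := by
      rw [div_le_iff₀' hkpos]
      exact_mod_cast hstep
    calc ((f Finset.univ - f (C (i + 1)) : ℤ) : ℝ)
        = ((f Finset.univ - f (C i) : ℤ) : ℝ) - ((f (C (i + 1)) - f (C i) : ℤ) : ℝ) := by
          push_cast
          ring
      _ ≤ ((f Finset.univ - f (C i) : ℤ) : ℝ) - ((f Finset.univ - f (C i) : ℤ) : ℝ) / k := by
          gcongr
      _ = (1 - 1 / (k : ℝ)) * ((f Finset.univ - f (C i) : ℤ) : ℝ) := by ring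
      _ ≤ (1 - 1 / (k : ℝ)) *
          ((1 - 1 / (k : ℝ)) ^ i * ((f Finset.univ - f ∅ : ℤ) : ℝ)) := by
          gcongr
      _ = (1 - 1 / (k : ℝ)) ^ (i + 1) * ((f Finset.univ - f ∅ : ℤ) : ℝ) := by ring
end

section
/- Let E be a finite set, let f : Finset E → ℤ be a monotone and submodular function, and let c ∈ ℤ. Then the truncated function g : Finset E → ℤ defined by g(A) = min(f(A), c) is also monotone and submodular. -/
/-- Truncating a monotone submodular function at a constant `c` preserves
monotonicity and submodularity. -/
theorem truncation_monotone_submodular {E : Type*} [Fintype E] [DecidableEq E]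
    (f : Finset E → ℤ) (hmono : Monotone f) (hsub : Submodular f) (c : ℤ) :
    Monotone (fun A : Finset E => min (f A) c) ∧
      Submodular (fun A : Finset E => min (f A) c) := by
  refine ⟨hmono.min monotone_const, fun B A hBA e he => ?_⟩
  have h₁ := hsub hBA e he
  have h₂ := hmono hBA
  have h₃ := hmono (Finset.subset_insert e B)
  dsimp only
  omega
end
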